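/- Let S ⊆ ℙ be a set of primes of Dirichlet density 1 and let χ : ℕ → ℝ be a multiplicative function taking values in {0,1} that is characteristic on S. Define g(z) := P_S(z) − log(1/(z−1)) on {Re z > 1}. Assume that g extends to a continuous function on {Re z ≥ 1} and that the difference quotient φ(z) := (g(z) − g(1))/(z−1), defined for Re z > 1, also extends to a continuous function on {Re z ≥ 1}. Then the set A := {n ∈ ℕ : χ(n) ≠ 0} has a natural density, and this natural density is strictly positive (it equals the constant a > 0 such that D_χ(z) − a/(z−1) extends continuously to {Re z ≥ 1}). -/

import Mathlib

open Filter Topology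

/-- The Euler factor at `p` of the Dirichlet series with coefficients `c`, divided by the
exponential of its linear term. -/
noncomputable def correctedFactor (c : ℕ → ℝ) (p : ℕ) (z : ℂ) : ℂ :=
  (∑' e : ℕ, (c (p ^ e) : ℂ) * ((p : ℂ) ^ (-z)) ^ e) * Complex.exp (-(c p * (p : ℂ) ^ (-z)))

lemma norm_powerSeries_mul_exp_sub_one_le {c : ℕ → ℂ} (hc0 : c 0 = 1) (hc : ∀ e, ‖c e‖ ≤ 1)
    {w : ℂ} (hw : ‖w‖ ≤ 3 / 4) :
    ‖(∑' e, c e * w ^ e) * Complex.exp (-(c 1 * w)) - 1‖ ≤ 15 * ‖w‖ ^ 2 := by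
  have hterm : ∀ e, ‖c e * w ^ e‖ ≤ (3 / 4 : ℝ) ^ e := fun e ↦ by
    rw [norm_mul, norm_pow]
    calc _ ≤ 1 * (3 / 4 : ℝ) ^ e := by gcongr; exact hc e
      _ = _ := one_mul _
  have hgeom : Summable fun e : ℕ ↦ (3 / 4 : ℝ) ^ e :=
    summable_geometric_of_lt_one (by norm_num) (by norm_num)
  have hs : Summable fun e ↦ c e * w ^ e := hgeom.of_norm_bounded hterm
  set v := c 1 * w with hv
  set R := ∑' e, c (e + 2) * w ^ e with hR
  have hsplit : ∑' e, c e * w ^ e = 1 + v + w ^ 2 * R := by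
    rw [← hs.sum_add_tsum_nat_add 2, hR, ← tsum_mul_left]
    simp only [Finset.sum_range_succ, Finset.sum_range_zero, hc0]
    congr 1
    · simp [hv]
    · exact tsum_congr fun e ↦ by ring
  have hRn : ‖R‖ ≤ 4 := by
    have : HasSum (fun e : ℕ ↦ (3 / 4 : ℝ) ^ e) 4 := by
      convert hasSum_geometric_of_lt_one (r := (3 / 4 : ℝ)) (by norm_num) (by norm_num) using 1
      norm_num
    refine tsum_of_norm_bounded this fun e ↦ ?_
    rw [norm_mul, norm_pow]
    calc _ ≤ 1 * (3 / 4 : ℝ) ^ e := by gcongr; exact hc _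
      _ = _ := one_mul _
  have hvw : ‖v‖ ≤ ‖w‖ := by
    rw [hv, norm_mul]
    exact mul_le_of_le_one_left (norm_nonneg _) (hc 1)
  have hv1 : ‖v‖ ≤ 1 := by linarith
  obtain ⟨E, hE⟩ : ∃ E, E = Complex.exp (-v) - 1 - -v := ⟨_, rfl⟩
  have hEn : ‖E‖ ≤ ‖w‖ ^ 2 := by
    rw [hE]
    refine (Complex.norm_exp_sub_one_sub_id_le (by simpa using hv1)).trans ?_
    rw [norm_neg]; gcongr
  have hexp : Complex.exp (-v) = 1 - v + E := by rw [hE]; ring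
  have hkey : (1 + v + w ^ 2 * R) * Complex.exp (-v) - 1
      = -v ^ 2 + E * (1 + v) + w ^ 2 * (R * (1 - v + E)) := by rw [hexp]; ring
  have hv34 : ‖v‖ ≤ 3 / 4 := hvw.trans hw
  have hE1 : ‖E‖ ≤ 9 / 16 := hEn.trans (by nlinarith [norm_nonneg w])
  have h1v : ‖1 + v‖ ≤ 2 := (norm_add_le _ _).trans (by rw [norm_one]; linarith)
  have h2 : ‖1 - v + E‖ ≤ 3 := by
    refine (norm_add_le _ _).trans ?_
    have := norm_sub_le (1 : ℂ) v
    rw [norm_one] at this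
    linarith
  rw [hsplit, hkey]
  calc _ ≤ ‖-v ^ 2‖ + ‖E * (1 + v)‖ + ‖w ^ 2 * (R * (1 - v + E))‖ := norm_add₃_le
    _ ≤ ‖w‖ ^ 2 + ‖w‖ ^ 2 * 2 + ‖w‖ ^ 2 * (4 * 3) := by
        simp only [norm_neg, norm_mul, norm_pow]
        gcongr
    _ = 15 * ‖w‖ ^ 2 := by ring

lemma norm_prime_cpow_neg_lt {p : ℕ} (hp : p.Prime) {z : ℂ} (hz : 3 / 4 < z.re) :
    ‖(p : ℂ) ^ (-z)‖ < 3 / 4 := by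
  rw [Complex.norm_natCast_cpow_of_pos hp.pos, Complex.neg_re]
  have h2 : (2 : ℝ) ≤ p := by exact_mod_cast hp.two_le
  calc (p : ℝ) ^ (-z.re) ≤ 2 ^ (-z.re) :=
        Real.rpow_le_rpow_of_nonpos (by norm_num) h2 (by linarith)
    _ ≤ (2 : ℝ) ^ (-(1 / 2) : ℝ) := Real.rpow_le_rpow_of_exponent_le (by norm_num) (by linarith)
    _ < 3 / 4 := by
        rw [Real.rpow_neg (by norm_num), ← Real.sqrt_eq_rpow]
        rw [inv_lt_comm₀ (by positivity) (by norm_num)]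
        exact Real.lt_sqrt_of_sq_lt (by norm_num)

lemma norm_correctedFactor_sub_one_le {c : ℕ → ℝ} (hc1 : c 1 = 1) (hc : ∀ n, ‖c n‖ ≤ 1)
    {p : ℕ} (hp : p.Prime) {z : ℂ} (hz : 3 / 4 < z.re) :
    ‖correctedFactor c p z - 1‖ ≤ 15 * (p : ℝ) ^ (-(3 / 2) : ℝ) := by
  have h := norm_powerSeries_mul_exp_sub_one_le (c := fun e ↦ (c (p ^ e) : ℂ))
    (by simp [hc1]) (fun e ↦ by simpa using hc _) (norm_prime_cpow_neg_lt hp hz).le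
  simp only [pow_one] at h
  refine h.trans ?_
  have h1 : (1 : ℝ) ≤ p := by exact_mod_cast hp.one_lt.le
  gcongr
  rw [Complex.norm_natCast_cpow_of_pos hp.pos, Complex.neg_re, ← Real.rpow_natCast,
    ← Real.rpow_mul (by positivity)]
  exact Real.rpow_le_rpow_of_exponent_le h1 (by push_cast; linarith)

lemma differentiableOn_correctedFactor {c : ℕ → ℝ} (hc : ∀ n, ‖c n‖ ≤ 1)
    {p : ℕ} (hp : p.Prime) :
    DifferentiableOn ℂ (correctedFactor c p) {z | 3 / 4 < z.re} := by
  have hp0 : (p : ℂ) ≠ 0 := by exact_mod_cast hp.ne_zero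
  have hw : Differentiable ℂ fun z : ℂ ↦ (p : ℂ) ^ (-z) := fun z ↦
    (differentiableAt_id.neg).const_cpow (Or.inl hp0)
  have hopen : IsOpen {z : ℂ | 3 / 4 < z.re} := isOpen_lt continuous_const Complex.continuous_re
  refine DifferentiableOn.mul ?_ ((hw.const_mul _).neg.cexp).differentiableOn
  refine Complex.differentiableOn_tsum_of_summable_norm (u := fun e ↦ (3 / 4 : ℝ) ^ e)
    (summable_geometric_of_lt_one (by norm_num) (by norm_num))
    (fun e ↦ ((hw.pow e).const_mul _).differentiableOn) hopen fun e z hz ↦ ?_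
  rw [norm_mul, norm_pow]
  calc _ ≤ 1 * (3 / 4 : ℝ) ^ e := by
        gcongr
        · simpa using hc _
        · exact (norm_prime_cpow_neg_lt hp hz).le
    _ = _ := one_mul _

lemma correctedFactor_one_ne_zero {c : ℕ → ℝ} (hc1 : c 1 = 1) (hc : ∀ n, ‖c n‖ ≤ 1)
    (hc0 : ∀ n, 0 ≤ c n) {p : ℕ} (hp : p.Prime) : correctedFactor c p 1 ≠ 0 := by
  refine mul_ne_zero ?_ (Complex.exp_ne_zero _)
  have hp1 : (p : ℝ)⁻¹ < 1 := inv_lt_one_of_one_lt₀ (by exact_mod_cast hp.one_lt)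
  have hs : Summable fun e ↦ c (p ^ e) * (p : ℝ)⁻¹ ^ e := by
    refine (summable_geometric_of_lt_one (by positivity) hp1).of_norm_bounded fun e ↦ ?_
    rw [norm_mul, norm_pow, norm_inv, Real.norm_natCast]
    exact mul_le_of_le_one_left (by positivity) (hc _)
  have hpos : 0 < ∑' e, c (p ^ e) * (p : ℝ)⁻¹ ^ e :=
    hs.tsum_pos (fun e ↦ mul_nonneg (hc0 _) (by positivity)) 0 (by simp [hc1])
  have hcast : ∑' e : ℕ, (c (p ^ e) : ℂ) * ((p : ℂ) ^ (-1 : ℂ)) ^ e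
      = ((∑' e, c (p ^ e) * (p : ℝ)⁻¹ ^ e : ℝ) : ℂ) := by
    rw [Complex.ofReal_tsum]
    refine tsum_congr fun e ↦ ?_
    rw [Complex.cpow_neg_one]
    push_cast
    rfl
  rw [hcast]
  exact_mod_cast hpos.ne'

/-- The quotient of the Dirichlet series with coefficients `c` by `exp (∑ c(p) p^{-z})`. -/
noncomputable def correctedProduct (c : ℕ → ℝ) (z : ℂ) : ℂ :=
  ∏' p : Nat.Primes, correctedFactor c p z

lemma summable_primes_rpow_neg_three_halves :
    Summable fun p : Nat.Primes ↦ 15 * ((p : ℕ) : ℝ) ^ (-(3 / 2) : ℝ) :=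
  (Nat.Primes.summable_rpow.mpr (by norm_num)).mul_left 15

lemma differentiableOn_correctedProduct {c : ℕ → ℝ} (hc1 : c 1 = 1) (hc : ∀ n, ‖c n‖ ≤ 1) :
    DifferentiableOn ℂ (correctedProduct c) {z | 3 / 4 < z.re} := by
  have hopen : IsOpen {z : ℂ | 3 / 4 < z.re} := isOpen_lt continuous_const Complex.continuous_re
  have h := Summable.hasProdLocallyUniformlyOn_one_add
    (f := fun (p : Nat.Primes) z ↦ correctedFactor c p z - 1) hopen
    summable_primes_rpow_neg_three_halves
    (.of_forall fun p z hz ↦ norm_correctedFactor_sub_one_le hc1 hc p.2 hz)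
    (fun p ↦ (differentiableOn_correctedFactor hc p.2).continuousOn.sub continuousOn_const)
  simp only [add_sub_cancel] at h
  refine h.differentiableOn (.of_forall fun s ↦ ?_) hopen
  simpa [Finset.prod_fn] using
    DifferentiableOn.finsetProd fun p _ ↦ differentiableOn_correctedFactor hc p.2

lemma correctedProduct_one_ne_zero {c : ℕ → ℝ} (hc1 : c 1 = 1) (hc : ∀ n, ‖c n‖ ≤ 1)
    (hc0 : ∀ n, 0 ≤ c n) : correctedProduct c 1 ≠ 0 := by
  have h := tprod_one_add_ne_zero_of_summable
    (f := fun p : Nat.Primes ↦ correctedFactor c p 1 - 1)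
    (fun p ↦ by simpa using correctedFactor_one_ne_zero hc1 hc hc0 p.2)
    (summable_primes_rpow_neg_three_halves.of_nonneg_of_le (fun _ ↦ norm_nonneg _)
      fun p ↦ norm_correctedFactor_sub_one_le hc1 hc p.2 (by norm_num))
  simpa only [correctedProduct, add_sub_cancel] using h

lemma summable_norm_mul_cpow_neg {c : ℕ → ℝ} (hc : ∀ n, ‖c n‖ ≤ 1) {z : ℂ} (hz : 1 < z.re) :
    Summable fun n : ℕ ↦ ‖(c n : ℂ) * (n : ℂ) ^ (-z)‖ := by
  refine (Real.summable_nat_rpow.mpr (neg_lt_neg hz)).of_nonneg_of_le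
    (fun _ ↦ norm_nonneg _) fun n ↦ ?_
  rcases n.eq_zero_or_pos with rfl | hn
  · have hz0 : -z ≠ 0 := fun h ↦ by simp [neg_eq_zero.mp h] at hz; linarith
    simp only [Nat.cast_zero, Complex.zero_cpow hz0, mul_zero, norm_zero]
    positivity
  · rw [norm_mul, Complex.norm_natCast_cpow_of_pos hn, Complex.neg_re]
    exact mul_le_of_le_one_left (by positivity) (by simpa using hc n)

theorem tsum_eq_exp_mul_correctedProduct {c : ℕ → ℝ} (hc1 : c 1 = 1) (hc : ∀ n, ‖c n‖ ≤ 1)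
    (hmul : ∀ m n : ℕ, Nat.Coprime m n → c (m * n) = c m * c n) {z : ℂ} (hz : 1 < z.re) :
    ∑' n : ℕ, (c n : ℂ) * (n : ℂ) ^ (-z) =
      Complex.exp (∑' p : Nat.Primes, (c p : ℂ) * ((p : ℕ) : ℂ) ^ (-z)) * correctedProduct c z := by
  have hz0 : -z ≠ 0 := fun h ↦ by simp [neg_eq_zero.mp h] at hz; linarith
  have hsum := summable_norm_mul_cpow_neg hc hz
  have hprod := EulerProduct.eulerProduct_hasProd (f := fun n : ℕ ↦ (c n : ℂ) * (n : ℂ) ^ (-z))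
    (by simp [hc1]) (fun {m n} hmn ↦ by
      simp only [hmul m n hmn, Nat.cast_mul, Complex.natCast_mul_natCast_cpow]
      push_cast; ring) hsum (by simp [Complex.zero_cpow hz0])
  have hP : Summable fun p : Nat.Primes ↦ (c p : ℂ) * ((p : ℕ) : ℂ) ^ (-z) :=
    hsum.of_norm.comp_injective Subtype.val_injective
  have hquot := hprod.mul hP.neg.hasSum.cexp
  have hfac : ∀ p : Nat.Primes, correctedFactor c p z =
      (∑' e : ℕ, (c ((p : ℕ) ^ e) : ℂ) * (((p : ℕ) ^ e : ℕ) : ℂ) ^ (-z)) *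
        Complex.exp (-(c p * ((p : ℕ) : ℂ) ^ (-z))) := fun p ↦ by
    unfold correctedFactor
    congr 1
    refine tsum_congr fun e ↦ ?_
    rw [Nat.cast_pow, ← Complex.natCast_cpow_natCast_mul, mul_comm (e : ℂ),
      Complex.cpow_mul_nat]
  have hval : correctedProduct c z = (∑' n : ℕ, (c n : ℂ) * (n : ℂ) ^ (-z)) *
      Complex.exp (∑' p : Nat.Primes, -((c p : ℂ) * ((p : ℕ) : ℂ) ^ (-z))) := by
    rw [← hquot.tprod_eq]
    exact tprod_congr hfac
  rw [hval, tsum_neg, Complex.exp_neg]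
  field_simp

lemma summable_of_multiplicative_of_primePow_le {f : ℕ → ℝ} (hf0 : f 0 = 0) (hf1 : f 1 = 1)
    (hf : ∀ n, 0 ≤ f n) (hmul : ∀ {m n : ℕ}, Nat.Coprime m n → f (m * n) = f m * f n)
    (hpow : ∀ {p : ℕ}, p.Prime → Summable fun k ↦ f (p ^ k)) {b : ℕ → ℝ} (hb : ∀ n, 0 ≤ b n)
    (hbs : Summable b) (hle : ∀ p : ℕ, p.Prime → ∑' k, f (p ^ (k + 1)) ≤ b p) : Summable f := by
  refine summable_of_sum_le hf (c := Real.exp (∑' n, b n)) fun u ↦ ?_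
  obtain ⟨N, hN⟩ := u.exists_nat_subset_range
  have hsmooth := (EulerProduct.summable_and_hasSum_smoothNumbers_prod_primesBelow_tsum hf1 hmul
    (fun hp ↦ (hpow hp).norm) N).2
  rw [show (fun m : N.smoothNumbers ↦ f m) = f ∘ (↑) from rfl,
    hasSum_subtype_iff_indicator] at hsmooth
  calc ∑ n ∈ u, f n = ∑ n ∈ u, (N.smoothNumbers).indicator f n := by
        refine Finset.sum_congr rfl fun n hn ↦ ?_
        rcases n.eq_zero_or_pos with rfl | hpos
        · simp [Set.indicator, hf0]
        · rw [Set.indicator_of_mem]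
          exact Nat.mem_smoothNumbers_of_lt hpos (Finset.mem_range.mp (hN hn))
    _ ≤ ∏ p ∈ N.primesBelow, ∑' e, f (p ^ e) :=
        sum_le_hasSum _ (fun n _ ↦ Set.indicator_nonneg (fun m _ ↦ hf m) n) hsmooth
    _ ≤ ∏ p ∈ N.primesBelow, Real.exp (b p) := by
        refine Finset.prod_le_prod (fun p _ ↦ tsum_nonneg fun e ↦ hf _) fun p hp ↦ ?_
        have hp' := Nat.prime_of_mem_primesBelow hp
        rw [(hpow hp').tsum_eq_zero_add, pow_zero, hf1, add_comm]
        exact (add_le_add_left (hle p hp') 1).trans (Real.add_one_le_exp _)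
    _ = Real.exp (∑ p ∈ N.primesBelow, b p) := (Real.exp_sum _ _).symm
    _ ≤ Real.exp (∑' n, b n) := Real.exp_le_exp.mpr (hbs.sum_le_tsum _ fun n _ ↦ hb n)

/-- Wintner's mean value theorem. -/
theorem tendsto_sum_mul_zeta_div {f : ArithmeticFunction ℝ}
    (hf : Summable fun n : ℕ ↦ |f n| / n) :
    Tendsto (fun N : ℕ ↦ (∑ n ∈ Finset.Ioc 0 N,
        (f * (ArithmeticFunction.zeta : ArithmeticFunction ℝ)) n) / N) atTop
      (𝓝 (∑' n : ℕ, f n / n)) := by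
  have hterm : ∀ n : ℕ, Tendsto (fun N : ℕ ↦ f n * ((N / n : ℕ) / (N : ℝ))) atTop
      (𝓝 (f n / n)) := fun n ↦ by
    have h := (tendsto_nat_floor_mul_div_atTop (R := ℝ) (a := (n : ℝ)⁻¹) (by positivity)).comp
      tendsto_natCast_atTop_atTop
    refine (h.const_mul (f n)).congr fun N ↦ ?_
    simp only [Function.comp_apply]
    rw [← Nat.floor_div_eq_div (K := ℝ), inv_mul_eq_div]
  refine (tendsto_tsum_of_dominated_convergence hf hterm ?_).congr fun N ↦ ?_
  · filter_upwards [eventually_gt_atTop 0] with N hN n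
    have hN' : (0 : ℝ) < N := by exact_mod_cast hN
    rw [Real.norm_eq_abs, abs_mul, div_eq_mul_inv |f n|]
    gcongr
    rw [abs_of_nonneg (by positivity), div_le_iff₀ hN', inv_mul_eq_div]
    exact Nat.cast_div_le
  · rw [ArithmeticFunction.sum_Ioc_mul_zeta_eq_sum, Finset.sum_div,
      tsum_eq_sum (s := Finset.Ioc 0 N)]
    · exact Finset.sum_congr rfl fun n _ ↦ by ring
    · intro n hn
      rcases n.eq_zero_or_pos with rfl | hpos
      · simp
      · have : N < n := by simpa [hpos] using hn
        simp [Nat.div_eq_of_lt this]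

theorem exists_mean_value_of_summable_one_sub {c : ℕ → ℝ} (hc1 : c 1 = 1) (hc0 : ∀ n, 0 ≤ c n)
    (hcle : ∀ n, c n ≤ 1) (hmul : ∀ m n : ℕ, Nat.Coprime m n → c (m * n) = c m * c n)
    (hs : Summable fun p : Nat.Primes ↦ (1 - c p) * ((p : ℕ) : ℝ)⁻¹) :
    ∃ a : ℝ, Tendsto (fun N : ℕ ↦ (∑ n ∈ Finset.Icc 1 N, c n) / N) atTop (𝓝 a) := by
  let C : ArithmeticFunction ℝ := ⟨fun n ↦ if n = 0 then 0 else c n, by simp⟩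
  have hC : ∀ n ≠ 0, C n = c n := fun n hn ↦ if_neg hn
  have hCmul : C.IsMultiplicative := by
    rw [ArithmeticFunction.IsMultiplicative.iff_ne_zero]
    refine ⟨by rw [hC 1 one_ne_zero, hc1], fun {m n} hm hn hmn ↦ ?_⟩
    rw [hC _ (mul_ne_zero hm hn), hC m hm, hC n hn, hmul m n hmn]
  let f : ArithmeticFunction ℝ := C * (ArithmeticFunction.moebius : ArithmeticFunction ℝ)
  have hfC : f * (ArithmeticFunction.zeta : ArithmeticFunction ℝ) = C := by
    rw [mul_assoc, ArithmeticFunction.coe_moebius_mul_coe_zeta, mul_one]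
  have hfmul : f.IsMultiplicative :=
    hCmul.mul ArithmeticFunction.isMultiplicative_moebius.intCast
  have hfpow : ∀ p : ℕ, p.Prime → ∀ k, f (p ^ (k + 1)) = c (p ^ (k + 1)) - c (p ^ k) :=
    fun p hp k ↦ by
      have key : ∀ j, ∑ i ∈ Finset.range (j + 1), f (p ^ i) = c (p ^ j) := fun j ↦ by
        rw [← hC _ (pow_ne_zero j hp.ne_zero), ← hfC, ArithmeticFunction.coe_mul_zeta_apply,
          Nat.sum_divisors_prime_pow hp]
      rw [← key (k + 1), ← key k, Finset.sum_range_succ _ (k + 1), add_sub_cancel_left]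
  have hfabs : ∀ p : ℕ, p.Prime → ∀ k, |f (p ^ k)| ≤ 1 := fun p hp k ↦ by
    cases k with
    | zero => simp [hfmul.map_one]
    | succ k =>
      rw [hfpow p hp, abs_le]
      constructor <;> linarith [hc0 (p ^ k), hc0 (p ^ (k + 1)), hcle (p ^ k), hcle (p ^ (k + 1))]
  have hbound : ∀ p : ℕ, p.Prime → ∀ k,
      |f (p ^ k)| / ((p ^ k : ℕ) : ℝ) ≤ (p : ℝ)⁻¹ ^ k := fun p hp k ↦ by
    rw [Nat.cast_pow, inv_pow, ← one_div]
    gcongr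
    exact hfabs p hp k
  have hpinv : ∀ p : ℕ, p.Prime → (p : ℝ)⁻¹ ≤ 1 / 2 := fun p hp ↦ by
    rw [inv_le_comm₀ (by exact_mod_cast hp.pos) (by norm_num)]
    norm_num
    exact_mod_cast hp.two_le
  have hgeom : ∀ p : ℕ, p.Prime → Summable fun k : ℕ ↦ (p : ℝ)⁻¹ ^ k := fun p hp ↦
    summable_geometric_of_lt_one (by positivity) ((hpinv p hp).trans_lt (by norm_num))
  have hpowsum : ∀ {p : ℕ}, p.Prime → Summable fun k ↦ |f (p ^ k)| / ((p ^ k : ℕ) : ℝ) :=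
    fun {p} hp ↦ (hgeom p hp).of_nonneg_of_le (fun k ↦ by positivity) (hbound p hp)
  have hsumm : Summable fun n : ℕ ↦ |f n| / n := by
    refine summable_of_multiplicative_of_primePow_le (by simp) (by simp [hfmul.map_one])
      (fun n ↦ by positivity) (fun {m n} hmn ↦ ?_) hpowsum
      (b := fun n ↦ {p : ℕ | p.Prime}.indicator (fun p ↦ (1 - c p) * (p : ℝ)⁻¹) n
        + 2 * ((n : ℝ) ^ 2)⁻¹) (fun n ↦ ?_) ?_ fun p hp ↦ ?_
    · rw [hfmul.map_mul_of_coprime hmn, abs_mul, Nat.cast_mul, mul_div_mul_comm]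
    · refine add_nonneg (Set.indicator_nonneg (fun p _ ↦ ?_) _) (by positivity)
      exact mul_nonneg (sub_nonneg.mpr (hcle p)) (by positivity)
    · refine Summable.add ?_ ((Real.summable_nat_pow_inv.mpr (by norm_num)).mul_left 2)
      exact summable_subtype_iff_indicator.mp hs
    · rw [Set.indicator_of_mem (show p ∈ {p : ℕ | p.Prime} from hp)]
      have hs1 := (summable_nat_add_iff 1).mpr (hpowsum hp)
      rw [hs1.tsum_eq_zero_add]
      refine add_le_add (le_of_eq ?_) ?_
      · rw [hfpow p hp]
        simp only [zero_add, pow_one, pow_zero, hc1]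
        rw [abs_sub_comm, abs_of_nonneg (sub_nonneg.mpr (hcle p)), div_eq_mul_inv]
      · calc ∑' k, |f (p ^ (k + 1 + 1))| / ((p ^ (k + 1 + 1) : ℕ) : ℝ)
            ≤ ∑' k : ℕ, (p : ℝ)⁻¹ ^ 2 * (p : ℝ)⁻¹ ^ k := by
              refine Summable.tsum_le_tsum (fun k ↦ ?_) ((summable_nat_add_iff 1).mpr hs1)
                ((hgeom p hp).mul_left _)
              rw [← pow_add, add_comm 2 k]
              exact hbound p hp _
          _ = (p : ℝ)⁻¹ ^ 2 * (1 - (p : ℝ)⁻¹)⁻¹ := by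
              rw [tsum_mul_left, tsum_geometric_of_lt_one (by positivity)
                ((hpinv p hp).trans_lt (by norm_num))]
          _ ≤ (p : ℝ)⁻¹ ^ 2 * 2 := by
              gcongr
              rw [inv_le_comm₀ (by linarith [hpinv p hp]) (by norm_num)]
              linarith [hpinv p hp]
          _ = 2 * ((p : ℝ) ^ 2)⁻¹ := by rw [inv_pow, mul_comm]
  refine ⟨_, (tendsto_sum_mul_zeta_div hsumm).congr fun N ↦ ?_⟩
  rw [hfC]
  congr 1
  refine Finset.sum_congr rfl fun n hn ↦ hC n ?_
  exact (Finset.mem_Ioc.mp hn).1.ne'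

lemma tendsto_ofReal_nhdsGT_one : Tendsto (fun x : ℝ ↦ (x : ℂ)) (𝓝[>] 1) (𝓝 1) := by
  exact_mod_cast (Complex.continuous_ofReal.tendsto 1).mono_left nhdsWithin_le_nhds

lemma tendsto_correctedProduct_one {c : ℕ → ℝ} (hc1 : c 1 = 1) (hc : ∀ n, ‖c n‖ ≤ 1) :
    Tendsto (fun x : ℝ ↦ correctedProduct c x) (𝓝[>] 1) (𝓝 (correctedProduct c 1)) := by
  have hopen : IsOpen {z : ℂ | 3 / 4 < z.re} := isOpen_lt continuous_const Complex.continuous_re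
  have hcont : ContinuousAt (correctedProduct c) 1 :=
    (differentiableOn_correctedProduct hc1 hc).continuousOn.continuousAt
      (hopen.mem_nhds (by norm_num))
  exact hcont.tendsto.comp tendsto_ofReal_nhdsGT_one

theorem summable_one_sub_mul_inv_of_tendsto {c : ℕ → ℝ} (hc0 : ∀ n, 0 ≤ c n)
    (hcle : ∀ n, c n ≤ 1) {L : ℂ} (hL : L ≠ 0)
    (hlim : Tendsto (fun x : ℝ ↦ ((x : ℂ) - 1) *
      Complex.exp (∑' p : Nat.Primes, (c p : ℂ) * ((p : ℕ) : ℂ) ^ (-(x : ℂ)))) (𝓝[>] 1) (𝓝 L)) :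
    Summable fun p : Nat.Primes ↦ (1 - c p) * ((p : ℕ) : ℝ)⁻¹ := by
  have hnorm : ∀ n, ‖c n‖ ≤ 1 := fun n ↦ by
    rw [Real.norm_eq_abs, abs_of_nonneg (hc0 n)]; exact hcle n
  have hone : ∀ n : ℕ, ‖(fun _ ↦ 1 : ℕ → ℝ) n‖ ≤ 1 := fun _ ↦ by simp
  have hH := tendsto_correctedProduct_one (c := fun _ ↦ 1) rfl hone
  have hH1 : correctedProduct (fun _ ↦ 1) 1 ≠ 0 :=
    correctedProduct_one_ne_zero rfl hone fun _ ↦ zero_le_one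
  have hzeta : Tendsto (fun x : ℝ ↦ ((x : ℂ) - 1) *
      ∑' n : ℕ, (((fun _ ↦ 1 : ℕ → ℝ) n : ℝ) : ℂ) * (n : ℂ) ^ (-(x : ℂ))) (𝓝[>] 1) (𝓝 1) := by
    have h : Tendsto (fun x : ℝ ↦ (x : ℂ)) (𝓝[>] 1) (𝓝[{s | 1 < s.re}] 1) :=
      tendsto_nhdsWithin_iff.mpr ⟨tendsto_ofReal_nhdsGT_one, by
        filter_upwards [self_mem_nhdsWithin] with x hx using by simpa using hx⟩
    refine (tendsto_sub_mul_tsum_nat_cpow.comp h).congr fun x ↦ ?_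
    simp [Complex.cpow_neg]
  set Q : ℝ → ℝ := fun x ↦ ∑' p : Nat.Primes, (1 - c p) * ((p : ℕ) : ℝ) ^ (-x) with hQ
  have hsummable : ∀ x : ℝ, 1 < x →
      Summable fun p : Nat.Primes ↦ (1 - c p) * ((p : ℕ) : ℝ) ^ (-x) := fun x hx ↦ by
    refine (Nat.Primes.summable_rpow.mpr (neg_lt_neg hx)).of_nonneg_of_le
      (fun p ↦ mul_nonneg (sub_nonneg.mpr (hcle p)) (by positivity)) fun p ↦ ?_
    exact mul_le_of_le_one_left (by positivity) (by linarith [hc0 p])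
  have hQexp : Tendsto (fun x : ℝ ↦ Complex.exp (Q x)) (𝓝[>] 1)
      (𝓝 (1 / correctedProduct (fun _ ↦ 1) 1 / L)) := by
    refine ((hzeta.div hH hH1).div hlim hL).congr' ?_
    filter_upwards [self_mem_nhdsWithin, hH.eventually_ne hH1] with x hx hHx
    have hx : 1 < x := hx
    have hxre : 1 < (x : ℂ).re := by simpa using hx
    have hx1 : (x : ℂ) - 1 ≠ 0 := sub_ne_zero.mpr (by exact_mod_cast hx.ne')
    have hs1 : Summable fun p : Nat.Primes ↦
        (((fun _ ↦ 1 : ℕ → ℝ) p : ℝ) : ℂ) * ((p : ℕ) : ℂ) ^ (-(x : ℂ)) :=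
      (summable_norm_mul_cpow_neg hone hxre).of_norm.comp_injective Subtype.val_injective
    have hsc : Summable fun p : Nat.Primes ↦ (c p : ℂ) * ((p : ℕ) : ℂ) ^ (-(x : ℂ)) :=
      (summable_norm_mul_cpow_neg hnorm hxre).of_norm.comp_injective Subtype.val_injective
    have hQx : (Q x : ℂ) =
        (∑' p : Nat.Primes, (((fun _ ↦ 1 : ℕ → ℝ) p : ℝ) : ℂ) * ((p : ℕ) : ℂ) ^ (-(x : ℂ)))
          - ∑' p : Nat.Primes, (c p : ℂ) * ((p : ℕ) : ℂ) ^ (-(x : ℂ)) := by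
      rw [← hs1.tsum_sub hsc, hQ, Complex.ofReal_tsum]
      refine tsum_congr fun p ↦ ?_
      rw [Complex.ofReal_mul, Complex.ofReal_cpow (Nat.cast_nonneg _)]
      push_cast
      ring
    simp only [Pi.div_apply]
    rw [tsum_eq_exp_mul_correctedProduct (c := fun _ ↦ 1) rfl hone (by simp) hxre, hQx,
      Complex.exp_sub]
    field_simp
  obtain ⟨B, hB⟩ : ∃ B, ∀ᶠ x in 𝓝[>] (1 : ℝ), Q x ≤ B := by
    refine ⟨‖1 / correctedProduct (fun _ ↦ 1) 1 / L‖ + 1, ?_⟩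
    filter_upwards [hQexp.norm.eventually_le_const (lt_add_one _)] with x hx
    rw [Complex.norm_exp, Complex.ofReal_re] at hx
    linarith [Real.add_one_le_exp (Q x)]
  refine summable_of_sum_le (c := B)
    (fun p ↦ mul_nonneg (sub_nonneg.mpr (hcle p)) (by positivity)) fun u ↦ ?_
  have hlim' : Tendsto (fun x : ℝ ↦ ∑ p ∈ u, (1 - c p) * ((p : ℕ) : ℝ) ^ (-x)) (𝓝[>] 1)
      (𝓝 (∑ p ∈ u, (1 - c p) * ((p : ℕ) : ℝ)⁻¹)) := by
    refine tendsto_finsetSum _ fun p _ ↦ Tendsto.const_mul _ ?_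
    rw [← Real.rpow_neg_one]
    have hp : ((p : ℕ) : ℝ) ≠ 0 := by exact_mod_cast p.2.ne_zero
    exact ((Real.continuousAt_const_rpow hp).tendsto.comp
      (continuous_neg.tendsto (1 : ℝ))).mono_left nhdsWithin_le_nhds
  refine le_of_tendsto hlim' ?_
  filter_upwards [hB, self_mem_nhdsWithin] with x hx hx1
  refine le_trans ?_ hx
  exact (hsummable x hx1).sum_le_tsum _ fun p _ ↦
    mul_nonneg (sub_nonneg.mpr (hcle p)) (by positivity)

/-- A multiplicative function with values in `[0, 1]` whose prime sum is asymptotic to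
`log (1 / (x - 1))` up to a convergent error has a positive mean value. -/
theorem exists_mean_value_of_tendsto {c : ℕ → ℝ} (hc1 : c 1 = 1) (hc0 : ∀ n, 0 ≤ c n)
    (hcle : ∀ n, c n ≤ 1) (hmul : ∀ m n : ℕ, Nat.Coprime m n → c (m * n) = c m * c n)
    {L : ℂ} (hL : L ≠ 0)
    (hlim : Tendsto (fun x : ℝ ↦ ((x : ℂ) - 1) *
      Complex.exp (∑' p : Nat.Primes, (c p : ℂ) * ((p : ℕ) : ℂ) ^ (-(x : ℂ)))) (𝓝[>] 1) (𝓝 L)) :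
    ∃ a : ℝ, 0 < a ∧ (a : ℂ) = L * correctedProduct c 1 ∧
      Tendsto (fun N : ℕ ↦ (∑ n ∈ Finset.Icc 1 N, c n) / N) atTop (𝓝 a) := by
  have hnorm : ∀ n, ‖c n‖ ≤ 1 := fun n ↦ by
    rw [Real.norm_eq_abs, abs_of_nonneg (hc0 n)]; exact hcle n
  obtain ⟨a, ha⟩ := exists_mean_value_of_summable_one_sub hc1 hc0 hcle hmul
    (summable_one_sub_mul_inv_of_tendsto hc0 hcle hL hlim)
  have habel := LSeries_tendsto_sub_mul_nhds_one_of_tendsto_sum_div_and_nonneg c ha hc0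
  have haeq : (a : ℂ) = L * correctedProduct c 1 := by
    refine tendsto_nhds_unique habel
      ((hlim.mul (tendsto_correctedProduct_one hc1 hnorm)).congr' ?_)
    filter_upwards [self_mem_nhdsWithin] with x hx
    have hx : 1 < x := hx
    rw [mul_assoc, ← tsum_eq_exp_mul_correctedProduct hc1 hnorm hmul (by simpa using hx), LSeries]
    congr 1
    refine tsum_congr fun n ↦ ?_
    have hx0 : (x : ℂ) ≠ 0 := by exact_mod_cast (zero_lt_one.trans hx).ne'
    rw [LSeries.term_of_ne_zero' hx0, Complex.cpow_neg, div_eq_mul_inv]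
  refine ⟨a, lt_of_le_of_ne (ge_of_tendsto' ha fun N ↦ ?_) ?_, haeq, ha⟩
  · exact div_nonneg (Finset.sum_nonneg fun n _ ↦ hc0 n) N.cast_nonneg
  · rintro rfl
    exact mul_ne_zero hL (correctedProduct_one_ne_zero hc1 hnorm hc0) (by simpa using haeq.symm)

lemma tendsto_ncard_support_div {c : ℕ → ℝ} (hval : ∀ n, c n = 0 ∨ c n = 1) {a : ℝ}
    (ha : Tendsto (fun N : ℕ ↦ (∑ n ∈ Finset.Icc 1 N, c n) / N) atTop (𝓝 a)) :
    Tendsto (fun x : ℝ ↦ ({n : ℕ | c n ≠ 0 ∧ (n : ℝ) ≤ x}.ncard : ℝ) / x) atTop (𝓝 a) := by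
  have h0 : Tendsto (fun x : ℝ ↦ c 0 / x) atTop (𝓝 0) := tendsto_const_nhds.div_atTop tendsto_id
  have h1 := (ha.comp (tendsto_nat_floor_atTop (α := ℝ))).mul
    (tendsto_nat_floor_div_atTop (R := ℝ))
  have h2 := h0.add h1
  rw [mul_one, zero_add] at h2
  refine h2.congr' ?_
  filter_upwards [eventually_ge_atTop 1] with x hx
  have hset : {n : ℕ | c n ≠ 0 ∧ (n : ℝ) ≤ x} =
      ((Finset.range (⌊x⌋₊ + 1)).filter fun n ↦ c n ≠ 0 : Finset ℕ) := by
    ext n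
    simp [Nat.le_floor_iff (zero_le_one.trans hx), and_comm]
  have hcard : (({n : ℕ | c n ≠ 0 ∧ (n : ℝ) ≤ x}.ncard : ℕ) : ℝ)
      = c 0 + ∑ n ∈ Finset.Icc 1 ⌊x⌋₊, c n := by
    rw [hset, Set.ncard_coe_finset, Finset.card_filter, Nat.cast_sum, Finset.range_eq_Ico,
      Finset.sum_eq_sum_Ico_succ_bot (Nat.succ_pos _)]
    have hite : ∀ n, ((if c n ≠ 0 then 1 else 0 : ℕ) : ℝ) = c n := fun n ↦ by
      rcases hval n with h | h <;> simp [h]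
    simp only [hite]
    rfl
  have hfloor : ((⌊x⌋₊ : ℕ) : ℝ) ≠ 0 := by exact_mod_cast (Nat.floor_pos.mpr hx).ne'
  have hx0 : x ≠ 0 := (zero_lt_one.trans_le hx).ne'
  rw [hcard]
  simp only [Function.comp_apply]
  field_simp

lemma tsum_primes_mul_eq_tsum_subtype {S : Set ℕ} (hS : ∀ p ∈ S, Nat.Prime p) {c : ℕ → ℝ}
    (hval : ∀ n, c n = 0 ∨ c n = 1) (hchar : ∀ p : ℕ, Nat.Prime p → (c p = 1 ↔ p ∈ S))
    (f : ℕ → ℂ) : ∑' p : Nat.Primes, (c p : ℂ) * f p = ∑' p : S, f p := by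
  rw [tsum_subtype S f]
  refine (tsum_subtype {p : ℕ | p.Prime} fun n ↦ (c n : ℂ) * f n).trans (tsum_congr fun n ↦ ?_)
  by_cases hn : n.Prime
  · rw [Set.indicator_of_mem (show n ∈ {p : ℕ | p.Prime} from hn)]
    by_cases hnS : n ∈ S
    · rw [Set.indicator_of_mem hnS, (hchar n hn).mpr hnS, Complex.ofReal_one, one_mul]
    · rw [Set.indicator_of_notMem hnS,
        (hval n).resolve_right fun h ↦ hnS ((hchar n hn).mp h), Complex.ofReal_zero, zero_mul]
  · rw [Set.indicator_of_notMem (show n ∉ {p : ℕ | p.Prime} from hn),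
      Set.indicator_of_notMem fun h ↦ hn (hS n h)]

/-- If `(G z - G 1) / (z - 1)` extends continuously to `1 ≤ re z`, then so does
`(exp (G z) * H z - exp (G 1) * H 1) / (z - 1)` for `H` holomorphic beyond the boundary. -/
lemma exists_continuousOn_exp_mul_div {G Φ H : ℂ → ℂ} {U : Set ℂ} (hU : IsOpen U)
    (hsub : {z : ℂ | 1 ≤ z.re} ⊆ U) (hH : DifferentiableOn ℂ H U)
    (hG : ContinuousOn G {z : ℂ | 1 ≤ z.re}) (hΦ : ContinuousOn Φ {z : ℂ | 1 ≤ z.re})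
    (hΦeq : ∀ z : ℂ, 1 < z.re → Φ z = (G z - G 1) / (z - 1)) :
    ∃ h : ℂ → ℂ, ContinuousOn h {z : ℂ | 1 ≤ z.re} ∧ ∀ z : ℂ, 1 < z.re →
      Complex.exp (G z) * H z / (z - 1) = Complex.exp (G 1) * H 1 / (z - 1) + h z := by
  have hU1 : U ∈ 𝓝 (1 : ℂ) := hU.mem_nhds (hsub (by simp))
  have hE : Continuous (dslope Complex.exp 0) := by
    rw [← continuousOn_univ, continuousOn_dslope univ_mem]
    exact ⟨Complex.continuous_exp.continuousOn, Complex.differentiableAt_exp⟩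
  have hK : ContinuousOn (dslope H 1) U :=
    (continuousOn_dslope hU1).mpr ⟨hH.continuousOn, hH.differentiableAt hU1⟩
  refine ⟨fun z ↦ H z * Complex.exp (G 1) * dslope Complex.exp 0 (G z - G 1) * Φ z +
    Complex.exp (G 1) * dslope H 1 z, ?_, fun z hz ↦ ?_⟩
  · exact ((((hH.continuousOn.mono hsub).mul continuousOn_const).mul
      (hE.comp_continuousOn (hG.sub continuousOn_const))).mul hΦ).add
      (continuousOn_const.mul (hK.mono hsub))
  · have hz1 : z - 1 ≠ 0 := fun h ↦ by
      rw [sub_eq_zero.mp h, Complex.one_re] at hz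
      exact lt_irrefl _ hz
    have h1 := sub_smul_dslope Complex.exp 0 (G z - G 1)
    have h2 := sub_smul_dslope H 1 z
    have h3 : Complex.exp (G z) = Complex.exp (G 1) * Complex.exp (G z - G 1) := by
      rw [← Complex.exp_add, add_sub_cancel]
    simp only [smul_eq_mul, sub_zero, Complex.exp_zero] at h1 h2
    beta_reduce
    rw [hΦeq z hz, h3]
    field_simp
    linear_combination (-H z) * h1 - h2

/-- Under the hypotheses of Statement 9, the set `A = {n : χ(n) ≠ 0}` has a
natural density, which is strictly positive: it equals the constant `a > 0` such that
`D_χ(z) − a/(z−1)` extends continuously to `{Re z ≥ 1}`. -/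
theorem natural_density_of_differentiable_error
    (S : Set ℕ) (hS : ∀ p ∈ S, Nat.Prime p)
    (hdens : Tendsto
      (fun z : ℝ => (∑' p : S, ((p : ℕ) : ℝ) ^ (-z)) / Real.log (1 / (z - 1)))
      (𝓝[>] 1) (𝓝 1))
    (χ : ℕ → ℝ) (hχ1 : χ 1 = 1)
    (hχmul : ∀ m n : ℕ, Nat.Coprime m n → χ (m * n) = χ m * χ n)
    (hχval : ∀ n : ℕ, χ n = 0 ∨ χ n = 1)
    (hchar : ∀ p : ℕ, Nat.Prime p → (χ p = 1 ↔ p ∈ S))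
    (G : ℂ → ℂ) (hGcont : ContinuousOn G {z : ℂ | 1 ≤ z.re})
    (hGeq : ∀ z : ℂ, 1 < z.re →
      G z = (∑' p : S, ((p : ℕ) : ℂ) ^ (-z)) - Complex.log (1 / (z - 1)))
    (Φ : ℂ → ℂ) (hΦcont : ContinuousOn Φ {z : ℂ | 1 ≤ z.re})
    (hΦeq : ∀ z : ℂ, 1 < z.re → Φ z = (G z - G 1) / (z - 1)) :
    ∃ a : ℝ, 0 < a ∧
      Tendsto (fun x : ℝ => ({n : ℕ | χ n ≠ 0 ∧ (n : ℝ) ≤ x}.ncard : ℝ) / x)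
        atTop (𝓝 a) ∧
      ∃ h : ℂ → ℂ, ContinuousOn h {z : ℂ | 1 ≤ z.re} ∧
        ∀ z : ℂ, 1 < z.re →
          (∑' n : ℕ, (χ n : ℂ) * (n : ℂ) ^ (-z)) = (a : ℂ) / (z - 1) + h z := by
  have hc0 : ∀ n, 0 ≤ χ n := fun n ↦ by rcases hχval n with h | h <;> simp [h]
  have hcle : ∀ n, χ n ≤ 1 := fun n ↦ by rcases hχval n with h | h <;> simp [h]
  have hnorm : ∀ n, ‖χ n‖ ≤ 1 := fun n ↦ by rcases hχval n with h | h <;> simp [h]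
  have hexp : ∀ z : ℂ, 1 < z.re →
      Complex.exp (∑' p : Nat.Primes, (χ p : ℂ) * ((p : ℕ) : ℂ) ^ (-z))
        = Complex.exp (G z) / (z - 1) := fun z hz ↦ by
    have hz1 : z - 1 ≠ 0 := fun h ↦ by
      rw [sub_eq_zero.mp h, Complex.one_re] at hz
      exact lt_irrefl _ hz
    rw [tsum_primes_mul_eq_tsum_subtype hS hχval hchar fun n ↦ (n : ℂ) ^ (-z), hGeq z hz,
      Complex.exp_sub, Complex.exp_log (one_div_ne_zero hz1)]
    field_simp
  have hlim : Tendsto (fun x : ℝ ↦ ((x : ℂ) - 1) *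
      Complex.exp (∑' p : Nat.Primes, (χ p : ℂ) * ((p : ℕ) : ℂ) ^ (-(x : ℂ)))) (𝓝[>] 1)
      (𝓝 (Complex.exp (G 1))) := by
    have hG1 : Tendsto (fun x : ℝ ↦ G x) (𝓝[>] 1) (𝓝 (G 1)) :=
      (hGcont 1 (by simp)).tendsto.comp <| tendsto_nhdsWithin_iff.mpr
        ⟨tendsto_ofReal_nhdsGT_one, by
          filter_upwards [self_mem_nhdsWithin] with x hx
          simpa using (show 1 < x from hx).le⟩
    refine hG1.cexp.congr' ?_
    filter_upwards [self_mem_nhdsWithin] with x hx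
    have hx : 1 < x := hx
    rw [hexp x (by simpa using hx),
      mul_div_cancel₀ _ (sub_ne_zero.mpr (by exact_mod_cast hx.ne'))]
  obtain ⟨a, hapos, haeq, ha⟩ :=
    exists_mean_value_of_tendsto hχ1 hc0 hcle hχmul (Complex.exp_ne_zero _) hlim
  obtain ⟨h, hcont, hh⟩ := exists_continuousOn_exp_mul_div
    (isOpen_lt continuous_const Complex.continuous_re)
    (fun z (hz : 1 ≤ z.re) ↦ show 3 / 4 < z.re by linarith)
    (differentiableOn_correctedProduct hχ1 hnorm) hGcont hΦcont hΦeq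
  refine ⟨a, hapos, tendsto_ncard_support_div hχval ha, h, hcont, fun z hz ↦ ?_⟩
  rw [tsum_eq_exp_mul_correctedProduct hχ1 hnorm hχmul hz, hexp z hz, haeq, ← hh z hz]
  ring
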